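/- For all real numbers x and y, Re[ (i/π) · ∫_0^{∞} ∫_{−∞}^{∞} erfc(√2·Y) · ((X − iY) − x) · exp(−(x − (X − iY))²/2 − (y − (X + iY))²/2) dX dY ] = −(1/(2√π))·e^{−(x−y)²/4} + (1/√(2π))·e^{−(x−y)²/2}. -/

import Mathlib

open MeasureTheory Real

/-- The complementary error function `erfc s = (2/√π) ∫_s^∞ e^{-t²} dt`. -/
noncomputable def erfc (s : ℝ) : ℝ := (2 / Real.sqrt π) * ∫ t in Set.Ioi s, Real.exp (-t ^ 2)

theorem integrable_exp_neg_sq : Integrable fun t : ℝ => Real.exp (-t ^ 2) := by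
  simpa using integrable_exp_neg_mul_sq one_pos

theorem erfc_zero : erfc 0 = 1 := by
  have h := integral_gaussian_Ioi 1
  simp only [neg_mul, one_mul, div_one] at h
  have hπ : Real.sqrt π ≠ 0 := (Real.sqrt_pos.2 pi_pos).ne'
  rw [erfc, h]
  field_simp

theorem hasDerivAt_erfc (s : ℝ) :
    HasDerivAt erfc (-(2 / Real.sqrt π * Real.exp (-s ^ 2))) s := by
  have hc : Continuous fun t : ℝ => Real.exp (-t ^ 2) := by fun_prop
  have h : erfc = fun s => 2 / Real.sqrt π *
      ((∫ t in Set.Ioi (0 : ℝ), Real.exp (-t ^ 2)) - ∫ t in (0 : ℝ)..s, Real.exp (-t ^ 2)) := by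
    funext s
    rw [erfc, ← intervalIntegral.integral_interval_add_Ioi' (hc.intervalIntegrable 0 s)
      integrable_exp_neg_sq.integrableOn]
    ring
  rw [h]
  exact (((hc.integral_hasStrictDerivAt 0 s).hasDerivAt.const_sub _).const_mul _).congr_deriv
    (by ring)

theorem erfc_nonneg (s : ℝ) : 0 ≤ erfc s :=
  mul_nonneg (by positivity) (integral_nonneg fun t => (Real.exp_pos _).le)

theorem erfc_le_exp_neg_sq {s : ℝ} (hs : 0 ≤ s) : erfc s ≤ Real.exp (-s ^ 2) := by
  have hshift : ∫ t in Set.Ioi s, Real.exp (-t ^ 2) =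
      ∫ t in Set.Ioi (0 : ℝ), Real.exp (-(t + s) ^ 2) := by
    have h := (measurePreserving_add_right volume s).setIntegral_preimage_emb
      (measurableEmbedding_addRight s) (fun t => Real.exp (-t ^ 2)) (Set.Ioi s)
    simpa using h.symm
  have hle : ∫ t in Set.Ioi (0 : ℝ), Real.exp (-(t + s) ^ 2) ≤
      ∫ t in Set.Ioi (0 : ℝ), Real.exp (-s ^ 2) * Real.exp (-t ^ 2) := by
    refine setIntegral_mono_on (integrable_exp_neg_sq.comp_add_right s).integrableOn
      (integrable_exp_neg_sq.const_mul _).integrableOn measurableSet_Ioi fun t ht => ?_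
    rw [← Real.exp_add]
    have : 0 ≤ t * s := mul_nonneg (le_of_lt ht) hs
    exact Real.exp_le_exp.2 (by nlinarith)
  rw [integral_const_mul] at hle
  calc erfc s ≤ 2 / Real.sqrt π *
        (Real.exp (-s ^ 2) * ∫ t in Set.Ioi (0 : ℝ), Real.exp (-t ^ 2)) := by
        rw [erfc, hshift]
        gcongr
    _ = Real.exp (-s ^ 2) * erfc 0 := by rw [erfc]; ring
    _ = Real.exp (-s ^ 2) := by rw [erfc_zero, mul_one]

theorem integral_ofReal_add_mul_exp_neg_sq (c : ℂ) :
    ∫ X : ℝ, ((X : ℂ) + c) * Complex.exp (-(X : ℂ) ^ 2) = c * (Real.sqrt π : ℂ) := by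
  have h1 : Integrable fun X : ℝ => ((X * Real.exp (-X ^ 2) : ℝ) : ℂ) := by
    have := integrable_mul_exp_neg_mul_sq one_pos
    simp only [neg_mul, one_mul] at this
    exact this.ofReal
  have h2 : Integrable fun X : ℝ => c * ((Real.exp (-X ^ 2) : ℝ) : ℂ) :=
    integrable_exp_neg_sq.ofReal.const_mul c
  have hodd : ∫ X : ℝ, X * Real.exp (-X ^ 2) = 0 := by
    have h := integral_neg_eq_self (fun X : ℝ => X * Real.exp (-X ^ 2)) volume
    simp only [neg_sq, neg_mul, integral_neg] at h
    linarith
  have hgauss : ∫ X : ℝ, Real.exp (-X ^ 2) = Real.sqrt π := by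
    simpa using integral_gaussian 1
  calc ∫ X : ℝ, ((X : ℂ) + c) * Complex.exp (-(X : ℂ) ^ 2)
      = ∫ X : ℝ, (((X * Real.exp (-X ^ 2) : ℝ) : ℂ) + c * ((Real.exp (-X ^ 2) : ℝ) : ℂ)) := by
        congr 1
        funext X
        push_cast
        ring
    _ = c * (Real.sqrt π : ℂ) := by
        rw [integral_add h1 h2, integral_const_mul, integral_complex_ofReal, integral_complex_ofReal, hodd, hgauss]
        simp

theorem norm_exp_sq_add_mul_I (Y d : ℝ) :
    ‖Complex.exp ((Y : ℂ) ^ 2 + Complex.I * d * Y)‖ = Real.exp (Y ^ 2) := by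
  rw [Complex.norm_exp]
  congr 1
  simp [← Complex.ofReal_pow]

theorem norm_erfc_mul_exp_le (d : ℝ) {Y : ℝ} (hY : 0 ≤ Y) :
    ‖((erfc (Real.sqrt 2 * Y) : ℝ) : ℂ) * Complex.exp ((Y : ℂ) ^ 2 + Complex.I * d * Y)‖ ≤
      Real.exp (-Y ^ 2) := by
  rw [norm_mul, norm_exp_sq_add_mul_I, Complex.norm_real, Real.norm_eq_abs,
    abs_of_nonneg (erfc_nonneg _)]
  calc erfc (Real.sqrt 2 * Y) * Real.exp (Y ^ 2)
      ≤ Real.exp (-(Real.sqrt 2 * Y) ^ 2) * Real.exp (Y ^ 2) := by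
        gcongr
        exact erfc_le_exp_neg_sq (by positivity)
    _ = Real.exp (-Y ^ 2) := by
        rw [← Real.exp_add, mul_pow, Real.sq_sqrt zero_le_two]
        ring_nf

theorem exp_neg_two_mul_sq_mul_exp (Y d : ℝ) :
    ((Real.exp (-(Real.sqrt 2 * Y) ^ 2) : ℝ) : ℂ) *
      Complex.exp ((Y : ℂ) ^ 2 + Complex.I * d * Y) =
      Complex.exp (-1 * (Y : ℂ) ^ 2 + Complex.I * d * Y + 0) := by
  rw [mul_pow, Real.sq_sqrt zero_le_two, Complex.ofReal_exp, ← Complex.exp_add]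
  push_cast
  ring_nf

theorem integral_erfc_mul_deriv_exp (d : ℝ) :
    ∫ Y in Set.Ioi (0 : ℝ), ((erfc (Real.sqrt 2 * Y) : ℝ) : ℂ) *
        ((2 * Y + Complex.I * d) * Complex.exp ((Y : ℂ) ^ 2 + Complex.I * d * Y)) =
      -1 + ((2 * Real.sqrt 2 / Real.sqrt π : ℝ) : ℂ) *
        ∫ Y in Set.Ioi (0 : ℝ), Complex.exp (-1 * (Y : ℂ) ^ 2 + Complex.I * d * Y + 0) := by
  let u : ℝ → ℂ := fun Y => ((erfc (Real.sqrt 2 * Y) : ℝ) : ℂ)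
  let v : ℝ → ℂ := fun Y => Complex.exp ((Y : ℂ) ^ 2 + Complex.I * d * Y)
  let u' : ℝ → ℂ := fun Y =>
    ((-(2 / Real.sqrt π * Real.exp (-(Real.sqrt 2 * Y) ^ 2)) * Real.sqrt 2 : ℝ) : ℂ)
  let v' : ℝ → ℂ := fun Y =>
    (2 * Y + Complex.I * d) * Complex.exp ((Y : ℂ) ^ 2 + Complex.I * d * Y)
  have hu (Y : ℝ) : HasDerivAt u (u' Y) Y := by
    have h := (hasDerivAt_erfc (Real.sqrt 2 * Y)).comp Y
      ((hasDerivAt_id Y).const_mul (Real.sqrt 2))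
    rw [mul_one] at h
    exact h.ofReal_comp
  have hv (Y : ℝ) : HasDerivAt v (v' Y) Y := by
    have h : HasDerivAt (fun z : ℂ => Complex.exp (z ^ 2 + Complex.I * d * z))
        (v' Y) (Y : ℂ) := by
      refine (((hasDerivAt_id (Y : ℂ)).pow 2).add
        ((hasDerivAt_id (Y : ℂ)).const_mul (Complex.I * d))).cexp.congr_deriv ?_
      simp [v', mul_comm]
    exact h.comp_ofReal
  have hu'v (Y : ℝ) : u' Y * v Y = -((2 * Real.sqrt 2 / Real.sqrt π : ℝ) : ℂ) *
      Complex.exp (-1 * (Y : ℂ) ^ 2 + Complex.I * d * Y + 0) := by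
    rw [← exp_neg_two_mul_sq_mul_exp]
    simp only [u', v]
    push_cast
    ring
  have hcu : Continuous u := continuous_iff_continuousAt.2 fun Y => (hu Y).continuousAt
  have hcv : Continuous v := continuous_iff_continuousAt.2 fun Y => (hv Y).continuousAt
  have hbound : IntegrableOn (u * v') (Set.Ioi 0) := by
    have hg : Integrable fun Y : ℝ => 2 * ‖Y * Real.exp (-Y ^ 2)‖ + |d| * Real.exp (-Y ^ 2) := by
      have := integrable_mul_exp_neg_mul_sq one_pos
      simp only [neg_mul, one_mul] at this
      exact (this.norm.const_mul 2).add (integrable_exp_neg_sq.const_mul _)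
    refine Integrable.mono' hg.integrableOn
      (hcu.mul (by fun_prop)).aestronglyMeasurable ?_
    refine (ae_restrict_iff' measurableSet_Ioi).2 (Filter.Eventually.of_forall fun Y hY => ?_)
    have hY0 : 0 ≤ Y := le_of_lt hY
    have hn : ‖(2 * Y + Complex.I * d : ℂ)‖ ≤ 2 * Y + |d| := by
      refine (norm_add_le _ _).trans_eq ?_
      simp [abs_of_nonneg hY0]
    calc ‖(u * v') Y‖ = ‖(2 * Y + Complex.I * d : ℂ)‖ * ‖u Y * v Y‖ := by
          rw [← norm_mul]
          simp only [Pi.mul_apply, u, v, v']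
          congr 1
          ring
      _ ≤ (2 * Y + |d|) * Real.exp (-Y ^ 2) := by
          gcongr
          exact norm_erfc_mul_exp_le d hY0
      _ = 2 * ‖Y * Real.exp (-Y ^ 2)‖ + |d| * Real.exp (-Y ^ 2) := by
          rw [Real.norm_of_nonneg (by positivity)]
          ring
  have hgauss : IntegrableOn (u' * v) (Set.Ioi 0) := by
    rw [show u' * v = _ from funext hu'v]
    exact ((integrable_cexp_quadratic (b := 1) (by simp) _ _).const_mul _).integrableOn
  have hzero : Filter.Tendsto (u * v) (nhdsWithin 0 (Set.Ioi 0)) (nhds 1) := by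
    have h := ((hcu.mul hcv).tendsto 0).mono_left (nhdsWithin_le_nhds (s := Set.Ioi 0))
    simpa [u, v, erfc_zero] using h
  have hinfty : Filter.Tendsto (u * v) Filter.atTop (nhds 0) := by
    refine squeeze_zero_norm' (a := fun Y => Real.exp (-Y ^ 2))
      ((Filter.eventually_ge_atTop 0).mono fun Y hY => norm_erfc_mul_exp_le d hY) ?_
    exact Real.tendsto_exp_neg_atTop_nhds_zero.comp (Filter.tendsto_pow_atTop two_ne_zero)
  have key := integral_Ioi_mul_deriv_eq_deriv_mul (fun Y _ => hu Y) (fun Y _ => hv Y)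
    hbound hgauss hzero hinfty
  simp only [hu'v, integral_const_mul] at key
  refine key.trans ?_
  ring

theorem re_integral_Ioi_cexp_neg_sq_add (d : ℝ) :
    (∫ Y in Set.Ioi (0 : ℝ), Complex.exp (-1 * (Y : ℂ) ^ 2 + Complex.I * d * Y + 0)).re =
      Real.sqrt π / 2 * Real.exp (-d ^ 2 / 4) := by
  have hint : Integrable fun Y : ℝ => Complex.exp (-1 * (Y : ℂ) ^ 2 + Complex.I * d * Y + 0) :=
    integrable_cexp_quadratic (b := 1) (by simp) _ _
  let f : ℝ → ℝ := fun Y => (Complex.exp (-1 * (Y : ℂ) ^ 2 + Complex.I * d * Y + 0)).re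
  have hf (Y : ℝ) : f Y = Real.exp (-Y ^ 2) * Real.cos (d * Y) := by
    simp only [f, Complex.exp_re]
    simp [← Complex.ofReal_pow]
  have habs (Y : ℝ) : f |Y| = f Y := by
    rw [hf, hf, sq_abs]
    congr 1
    rcases abs_choice Y with h | h <;> simp [h]
  have hfull : ∫ Y, f Y = Real.sqrt π * Real.exp (-d ^ 2 / 4) := by
    have h := congrArg Complex.re
      (integral_cexp_quadratic (b := -1) (by simp) (Complex.I * d) 0)
    rw [show (∫ Y : ℝ, Complex.exp (-1 * (Y : ℂ) ^ 2 + Complex.I * d * Y + 0)).re = ∫ Y, f Y from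
      (integral_re hint).symm] at h
    rw [h]
    have h1 : ((π : ℂ) / -(-1)) ^ (1 / 2 : ℂ) = ((Real.sqrt π : ℝ) : ℂ) := by
      rw [Real.sqrt_eq_rpow, Complex.ofReal_cpow pi_pos.le]
      simp
    have h2 : Complex.exp (0 - (Complex.I * d) ^ 2 / (4 * -1)) =
        ((Real.exp (-d ^ 2 / 4) : ℝ) : ℂ) := by
      rw [mul_pow, Complex.I_sq]
      push_cast
      ring_nf
    rw [h1, h2, ← Complex.ofReal_mul, Complex.ofReal_re]
  have hhalf := integral_comp_abs (f := f)
  simp only [habs] at hhalf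
  rw [hfull] at hhalf
  have hre : (∫ Y in Set.Ioi (0 : ℝ),
      Complex.exp (-1 * (Y : ℂ) ^ 2 + Complex.I * d * Y + 0)).re = ∫ Y in Set.Ioi (0 : ℝ), f Y :=
    (integral_re hint.integrableOn).symm
  rw [hre]
  linarith

theorem integral_sub_mul_exp_neg_sq_sub_sq (x y Y : ℝ) :
    ∫ X : ℝ, (((X : ℂ) - Complex.I * (Y : ℂ)) - (x : ℂ)) *
        Complex.exp (-((x : ℂ) - ((X : ℂ) - Complex.I * (Y : ℂ))) ^ 2 / 2 -
          ((y : ℂ) - ((X : ℂ) + Complex.I * (Y : ℂ))) ^ 2 / 2) =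
      -(Complex.I / 2 * Real.sqrt π * Real.exp (-(x - y) ^ 2 / 4)) *
        ((2 * Y + Complex.I * ((y - x : ℝ) : ℂ)) *
          Complex.exp ((Y : ℂ) ^ 2 + Complex.I * ((y - x : ℝ) : ℂ) * Y)) := by
  rw [← integral_add_right_eq_self _ ((x + y) / 2)]
  have h (X : ℝ) : ((((X + (x + y) / 2 : ℝ) : ℂ) - Complex.I * (Y : ℂ)) - (x : ℂ)) *
      Complex.exp (-((x : ℂ) - (((X + (x + y) / 2 : ℝ) : ℂ) - Complex.I * (Y : ℂ))) ^ 2 / 2 -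
        ((y : ℂ) - (((X + (x + y) / 2 : ℝ) : ℂ) + Complex.I * (Y : ℂ))) ^ 2 / 2) =
      (Real.exp (-(x - y) ^ 2 / 4) *
          Complex.exp ((Y : ℂ) ^ 2 + Complex.I * ((y - x : ℝ) : ℂ) * Y)) *
        (((X : ℂ) + ((y - x) / 2 - Complex.I * Y)) * Complex.exp (-(X : ℂ) ^ 2)) := by
    have hexp : -((x : ℂ) - (((X + (x + y) / 2 : ℝ) : ℂ) - Complex.I * (Y : ℂ))) ^ 2 / 2 -
        ((y : ℂ) - (((X + (x + y) / 2 : ℝ) : ℂ) + Complex.I * (Y : ℂ))) ^ 2 / 2 =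
        ((-(x - y) ^ 2 / 4 : ℝ) : ℂ) + ((Y : ℂ) ^ 2 + Complex.I * ((y - x : ℝ) : ℂ) * Y) +
          -(X : ℂ) ^ 2 := by
      push_cast
      linear_combination (-(Y : ℂ) ^ 2) * Complex.I_sq
    rw [hexp, Complex.exp_add, Complex.exp_add, Complex.ofReal_exp]
    push_cast
    ring
  simp only [h, integral_const_mul, integral_ofReal_add_mul_exp_neg_sq]
  push_cast
  linear_combination (Complex.exp (-((x : ℂ) - y) ^ 2 / 4) *
    Complex.exp ((Y : ℂ) ^ 2 + Complex.I * (y - x) * Y) * Real.sqrt π * ((y : ℂ) - x) / 2) *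
      Complex.I_sq

/-- Evaluation of the `(1,1)`-component of `∫_{ℝ₊²} K̃_{r,c}(x,z) K̃_{c,r}(z,y) d²z` for the
bulk-scaled real Ginibre kernel. -/
theorem stmt_15 (x y : ℝ) :
    (Complex.I / (π : ℂ) *
        ∫ Y in Set.Ioi (0 : ℝ), ∫ X : ℝ,
          ((erfc (Real.sqrt 2 * Y) : ℝ) : ℂ) * (((X : ℂ) - Complex.I * (Y : ℂ)) - (x : ℂ)) *
            Complex.exp (-((x : ℂ) - ((X : ℂ) - Complex.I * (Y : ℂ))) ^ 2 / 2 -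
              ((y : ℂ) - ((X : ℂ) + Complex.I * (Y : ℂ))) ^ 2 / 2)).re =
      -(1 / (2 * Real.sqrt π)) * Real.exp (-(x - y) ^ 2 / 4) +
        (1 / Real.sqrt (2 * π)) * Real.exp (-(x - y) ^ 2 / 2) := by
  have hX (Y : ℝ) := integral_sub_mul_exp_neg_sq_sub_sq x y Y
  have hre := re_integral_Ioi_cexp_neg_sq_add (y - x)
  have hY := integral_erfc_mul_deriv_exp (y - x)
  have hs : ((Real.sqrt π : ℝ) : ℂ) ^ 2 = π := by
    rw [← Complex.ofReal_pow, Real.sq_sqrt pi_pos.le]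
  have hs0 : ((Real.sqrt π : ℝ) : ℂ) ≠ 0 :=
    Complex.ofReal_ne_zero.2 (Real.sqrt_pos.2 pi_pos).ne'
  have hfactor (J : ℂ) : Complex.I / (π : ℂ) *
      (-(Complex.I / 2 * Real.sqrt π * Real.exp (-(x - y) ^ 2 / 4)) *
        (-1 + ((2 * Real.sqrt 2 / Real.sqrt π : ℝ) : ℂ) * J)) =
      ((1 / (2 * Real.sqrt π) * Real.exp (-(x - y) ^ 2 / 4) : ℝ) : ℂ) *
        (-1 + ((2 * Real.sqrt 2 / Real.sqrt π : ℝ) : ℂ) * J) := by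
    rw [← mul_assoc]
    congr 1
    rw [← hs]
    push_cast
    field_simp
    linear_combination (-1 : ℂ) * Complex.I_sq
  have hinner (Y : ℝ) : ∫ X : ℝ,
      ((erfc (Real.sqrt 2 * Y) : ℝ) : ℂ) * (((X : ℂ) - Complex.I * (Y : ℂ)) - (x : ℂ)) *
        Complex.exp (-((x : ℂ) - ((X : ℂ) - Complex.I * (Y : ℂ))) ^ 2 / 2 -
          ((y : ℂ) - ((X : ℂ) + Complex.I * (Y : ℂ))) ^ 2 / 2) =
      -(Complex.I / 2 * Real.sqrt π * Real.exp (-(x - y) ^ 2 / 4)) *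
        (((erfc (Real.sqrt 2 * Y) : ℝ) : ℂ) * ((2 * Y + Complex.I * ((y - x : ℝ) : ℂ)) *
          Complex.exp ((Y : ℂ) ^ 2 + Complex.I * ((y - x : ℝ) : ℂ) * Y))) := by
    rw [mul_left_comm, ← hX, ← integral_const_mul]
    simp only [mul_assoc]
  simp only [hinner, integral_const_mul]
  rw [hY, hfactor, Complex.re_ofReal_mul, Complex.add_re, Complex.re_ofReal_mul, hre]
  have hexp : Real.exp (-(y - x) ^ 2 / 4) * Real.exp (-(x - y) ^ 2 / 4) =
      Real.exp (-(x - y) ^ 2 / 2) := by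
    rw [← Real.exp_add]
    ring_nf
  have h2 : Real.sqrt 2 ^ 2 = 2 := Real.sq_sqrt zero_le_two
  have hπ : Real.sqrt π ≠ 0 := (Real.sqrt_pos.2 pi_pos).ne'
  rw [← hexp, Real.sqrt_mul zero_le_two]
  simp only [Complex.neg_re, Complex.one_re]
  field_simp
  linear_combination Real.exp (-((y - x) ^ 2 / 4)) * h2
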